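/- Under hypotheses (h1), (g1), (O), with N ≥ 3, a, b nonnegative continuous functions on [0,∞), and u₀ ≥ s₀, the iteration sequence u_0(r) := u₀, u_n(r) := u₀ + ∫₀^r t^{1-N} ∫₀^t s^{N-1} (a(s) h(u_{n-1}(s)) + b(s) g(u_{n-1}(s))) ds dt converges locally uniformly on [0,∞) to a function u ∈ C²([0,∞)) with u ≥ u₀ > 0 that satisfies u''(r) + ((N-1)/r) u'(r) = a(r) h(u(r)) + b(r) g(u(r)) for every r > 0, together with u(0) = u₀ and u'(0) = 0. -/

import Mathlib

open MeasureTheory Filter Set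

/-- The weighted average `∫₀¹ σ ^ (N - 1) φ (t σ) dσ` of a radial profile `φ`. -/
noncomputable def radialMean (N : ℕ) (φ : ℝ → ℝ) (t : ℝ) : ℝ :=
  ∫ σ in (0:ℝ)..1, σ ^ (N - 1) * φ (t * σ)

/-- The solution `∫₀ʳ t¹⁻ᴺ ∫₀ᵗ sᴺ⁻¹ φ(s) ds dt` of the radial Poisson equation with zero data at the
origin, written through `radialMean`. -/
noncomputable def radialPotential (N : ℕ) (φ : ℝ → ℝ) (r : ℝ) : ℝ :=
  ∫ t in (0:ℝ)..r, t * radialMean N φ t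

section RadialMean

variable {N : ℕ} {φ ψ : ℝ → ℝ} {r t : ℝ}

lemma zpow_mul_integral_eq_mul_radialMean (hN : 1 ≤ N) (φ : ℝ → ℝ) (t : ℝ) :
    t ^ (1 - (N:ℤ)) * ∫ s in (0:ℝ)..t, s ^ (N - 1) * φ s = t * radialMean N φ t := by
  obtain ⟨m, rfl⟩ : ∃ m, N = m + 1 := ⟨N - 1, by omega⟩
  rcases eq_or_ne t 0 with rfl | ht
  · simp
  have key := intervalIntegral.smul_integral_comp_mul_left (a := 0) (b := 1)
    (fun s => s ^ m * φ s) t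
  simp only [mul_zero, mul_one, smul_eq_mul, mul_pow, mul_assoc] at key
  rw [intervalIntegral.integral_const_mul] at key
  have hz : t ^ (1 - ((m + 1 : ℕ) : ℤ)) = (t ^ m)⁻¹ := by
    rw [show (1 - ((m + 1 : ℕ) : ℤ)) = -(m : ℤ) by push_cast; ring, zpow_neg, zpow_natCast]
  simp only [radialMean, Nat.add_sub_cancel]
  rw [hz, ← key]
  field_simp

lemma continuous_radialMean (hφ : Continuous φ) : Continuous (radialMean N φ) := by
  unfold radialMean
  apply intervalIntegral.continuous_parametric_intervalIntegral_of_continuous'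
  fun_prop

lemma intervalIntegrable_radialMean (hφ : Continuous φ) :
    IntervalIntegrable (fun σ => σ ^ (N - 1) * φ (t * σ)) volume 0 1 := by
  apply Continuous.intervalIntegrable
  fun_prop

lemma mul_mem_Icc_of_mem_unitInterval {σ : ℝ} (ht : 0 ≤ t) (hσ : σ ∈ Icc (0:ℝ) 1) :
    t * σ ∈ Icc 0 t :=
  ⟨mul_nonneg ht hσ.1, mul_le_of_le_one_right ht hσ.2⟩

lemma radialMean_mono (hφ : Continuous φ) (hψ : Continuous ψ) (ht : 0 ≤ t)
    (hle : ∀ s ∈ Icc 0 t, φ s ≤ ψ s) : radialMean N φ t ≤ radialMean N ψ t :=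
  intervalIntegral.integral_mono_on zero_le_one (intervalIntegrable_radialMean hφ)
    (intervalIntegrable_radialMean hψ) fun _ hσ =>
      mul_le_mul_of_nonneg_left (hle _ (mul_mem_Icc_of_mem_unitInterval ht hσ))
        (pow_nonneg hσ.1 _)

lemma radialMean_nonneg (ht : 0 ≤ t) (hφ : ∀ s ∈ Icc 0 t, 0 ≤ φ s) : 0 ≤ radialMean N φ t :=
  intervalIntegral.integral_nonneg zero_le_one fun _ hσ =>
    mul_nonneg (pow_nonneg hσ.1 _) (hφ _ (mul_mem_Icc_of_mem_unitInterval ht hσ))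

lemma radialMean_le {C : ℝ} (hφ : Continuous φ) (ht : 0 ≤ t) (hφ0 : ∀ s ∈ Icc 0 t, 0 ≤ φ s)
    (hC : ∀ s ∈ Icc 0 t, φ s ≤ C) : radialMean N φ t ≤ C := by
  have hle : radialMean N φ t ≤ ∫ _ in (0:ℝ)..1, C := by
    refine intervalIntegral.integral_mono_on zero_le_one (intervalIntegrable_radialMean hφ)
      (by simp) fun σ hσ => ?_
    have hmem := mul_mem_Icc_of_mem_unitInterval ht hσ
    exact (mul_le_of_le_one_left (hφ0 _ hmem) (pow_le_one₀ hσ.1 hσ.2)).trans (hC _ hmem)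
  simpa using hle

lemma tendsto_radialMean {Φ : ℕ → ℝ → ℝ} (hΦ : ∀ n, Continuous (Φ n)) (hφ : Continuous φ)
    (ht : 0 ≤ t) (h0 : ∀ n, ∀ s ∈ Icc 0 t, 0 ≤ Φ n s) (hle : ∀ n, ∀ s ∈ Icc 0 t, Φ n s ≤ φ s)
    (hlim : ∀ s ∈ Icc 0 t, Tendsto (fun n => Φ n s) atTop (nhds (φ s))) :
    Tendsto (fun n => radialMean N (Φ n) t) atTop (nhds (radialMean N φ t)) := by
  have hmem : ∀ σ ∈ uIoc (0:ℝ) 1, σ ∈ Icc (0:ℝ) 1 := fun σ hσ => by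
    rw [uIoc_of_le zero_le_one] at hσ
    exact Ioc_subset_Icc_self hσ
  refine intervalIntegral.tendsto_integral_filter_of_dominated_convergence
    (fun σ => σ ^ (N - 1) * φ (t * σ)) (Eventually.of_forall fun n => ?_)
    (Eventually.of_forall fun n => Eventually.of_forall fun σ hσ => ?_)
    (intervalIntegrable_radialMean hφ) (Eventually.of_forall fun σ hσ => ?_)
  · have := hΦ n
    exact Continuous.aestronglyMeasurable (by fun_prop)
  · have hσ1 := hmem σ hσ
    have hs := mul_mem_Icc_of_mem_unitInterval ht hσ1
    have hp : 0 ≤ σ ^ (N - 1) := pow_nonneg hσ1.1 _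
    rw [Real.norm_of_nonneg (mul_nonneg hp (h0 n _ hs))]
    exact mul_le_mul_of_nonneg_left (hle n _ hs) hp
  · exact (hlim _ (mul_mem_Icc_of_mem_unitInterval ht (hmem σ hσ))).const_mul _

lemma radialMean_zero (hN : 1 ≤ N) (φ : ℝ → ℝ) : radialMean N φ 0 = φ 0 / N := by
  obtain ⟨m, rfl⟩ : ∃ m, N = m + 1 := ⟨N - 1, by omega⟩
  simp [radialMean, integral_pow, div_eq_inv_mul]

lemma hasDerivAt_mul_radialMean (hN : 1 ≤ N) (hφ : Continuous φ) (t : ℝ) :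
    HasDerivAt (fun t => t * radialMean N φ t) (φ t - ((N:ℝ) - 1) * radialMean N φ t) t := by
  rcases eq_or_ne t 0 with rfl | ht
  · have hN0 : (N:ℝ) ≠ 0 := by positivity
    have hval : φ 0 - ((N:ℝ) - 1) * radialMean N φ 0 = radialMean N φ 0 := by
      rw [radialMean_zero hN]
      field_simp
      ring
    rw [hval, hasDerivAt_iff_tendsto_slope]
    refine ((continuous_radialMean hφ).continuousAt.tendsto.mono_left nhdsWithin_le_nhds).congr' ?_
    filter_upwards [self_mem_nhdsWithin] with y hy
    have hy : y ≠ 0 := hy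
    simp [slope, hy]
  · simp_rw [← zpow_mul_integral_eq_mul_radialMean hN]
    have hcont : Continuous fun s => s ^ (N - 1) * φ s := by fun_prop
    have hd := (hasDerivAt_zpow (1 - (N:ℤ)) t (Or.inl ht)).mul
      (hcont.integral_hasStrictDerivAt 0 t).hasDerivAt
    refine hd.congr_deriv ?_
    have hmean : radialMean N φ t =
        t⁻¹ * (t ^ (1 - (N:ℤ)) * ∫ s in (0:ℝ)..t, s ^ (N - 1) * φ s) := by
      rw [zpow_mul_integral_eq_mul_radialMean hN]
      field_simp
    have hpow : t ^ (1 - (N:ℤ)) * t ^ (N - 1) = 1 := by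
      rw [← zpow_natCast, ← zpow_add₀ ht]
      simp [Nat.cast_sub hN]
    rw [hmean, zpow_sub_one₀ ht, ← mul_assoc _ (t ^ (N - 1)), hpow]
    push_cast
    ring

lemma hasDerivAt_radialPotential (hφ : Continuous φ) (r : ℝ) :
    HasDerivAt (radialPotential N φ) (r * radialMean N φ r) r :=
  (Continuous.integral_hasStrictDerivAt
    (continuous_id.mul (continuous_radialMean hφ)) 0 r).hasDerivAt

lemma continuous_radialPotential (hφ : Continuous φ) : Continuous (radialPotential N φ) :=
  continuous_iff_continuousAt.2 fun r => (hasDerivAt_radialPotential hφ r).continuousAt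

lemma contDiff_two_radialPotential (hN : 1 ≤ N) (hφ : Continuous φ) :
    ContDiff ℝ 2 (radialPotential N φ) := by
  have hd : deriv (radialPotential N φ) = fun t => t * radialMean N φ t :=
    funext fun r => (hasDerivAt_radialPotential hφ r).deriv
  have hd2 : deriv (fun t => t * radialMean N φ t) =
      fun t => φ t - ((N:ℝ) - 1) * radialMean N φ t :=
    funext fun r => (hasDerivAt_mul_radialMean hN hφ r).deriv
  rw [show (2 : WithTop ℕ∞) = 1 + 1 by norm_num, contDiff_succ_iff_deriv]
  refine ⟨fun r => (hasDerivAt_radialPotential hφ r).differentiableAt, by simp, ?_⟩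
  rw [hd, contDiff_one_iff_deriv, hd2]
  exact ⟨fun r => (hasDerivAt_mul_radialMean hN hφ r).differentiableAt,
    hφ.sub (continuous_const.mul (continuous_radialMean hφ))⟩

lemma radialPotential_nonneg (hr : 0 ≤ r) (hφ : ∀ s ∈ Icc 0 r, 0 ≤ φ s) :
    0 ≤ radialPotential N φ r :=
  intervalIntegral.integral_nonneg hr fun _ ht =>
    mul_nonneg ht.1 (radialMean_nonneg ht.1 fun s hs => hφ s ⟨hs.1, hs.2.trans ht.2⟩)

lemma radialPotential_mono (hφ : Continuous φ) (hψ : Continuous ψ) (hr : 0 ≤ r)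
    (hle : ∀ s ∈ Icc 0 r, φ s ≤ ψ s) : radialPotential N φ r ≤ radialPotential N ψ r :=
  intervalIntegral.integral_mono_on hr
    ((continuous_id.mul (continuous_radialMean hφ)).intervalIntegrable _ _)
    ((continuous_id.mul (continuous_radialMean hψ)).intervalIntegrable _ _) fun _ ht =>
      mul_le_mul_of_nonneg_left
        (radialMean_mono hφ hψ ht.1 fun s hs => hle s ⟨hs.1, hs.2.trans ht.2⟩) ht.1

lemma tendsto_radialPotential {Φ : ℕ → ℝ → ℝ} (hΦ : ∀ n, Continuous (Φ n)) (hφ : Continuous φ)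
    (hr : 0 ≤ r) (h0 : ∀ n, ∀ s ∈ Icc 0 r, 0 ≤ Φ n s) (hle : ∀ n, ∀ s ∈ Icc 0 r, Φ n s ≤ φ s)
    (hlim : ∀ s ∈ Icc 0 r, Tendsto (fun n => Φ n s) atTop (nhds (φ s))) :
    Tendsto (fun n => radialPotential N (Φ n) r) atTop (nhds (radialPotential N φ r)) := by
  have hmem : ∀ t ∈ uIoc 0 r, 0 ≤ t ∧ Icc 0 t ⊆ Icc 0 r := fun t ht => by
    rw [uIoc_of_le hr] at ht
    exact ⟨ht.1.le, Icc_subset_Icc_right ht.2⟩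
  refine intervalIntegral.tendsto_integral_filter_of_dominated_convergence
    (fun t => t * radialMean N φ t) (Eventually.of_forall fun n => ?_)
    (Eventually.of_forall fun n => Eventually.of_forall fun t ht => ?_)
    ((continuous_id.mul (continuous_radialMean hφ)).intervalIntegrable _ _)
    (Eventually.of_forall fun t ht => ?_)
  · exact (continuous_id.mul (continuous_radialMean (hΦ n))).aestronglyMeasurable
  · obtain ⟨ht0, hsub⟩ := hmem t ht
    rw [Real.norm_of_nonneg (mul_nonneg ht0
      (radialMean_nonneg ht0 fun s hs => h0 n s (hsub hs)))]
    exact mul_le_mul_of_nonneg_left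
      (radialMean_mono (hΦ n) hφ ht0 fun s hs => hle n s (hsub hs)) ht0
  · obtain ⟨ht0, hsub⟩ := hmem t ht
    exact (tendsto_radialMean hΦ hφ ht0 (fun n s hs => h0 n s (hsub hs))
      (fun n s hs => hle n s (hsub hs)) fun s hs => hlim s (hsub hs)).const_mul _

end RadialMean

/-- The Picard iterates of the integral equation `u = u₀ + radialPotential N (f(·, u(·)))`. -/
noncomputable def radialPicard (N : ℕ) (f : ℝ → ℝ → ℝ) (u₀ : ℝ) : ℕ → ℝ → ℝ
  | 0 => fun _ => u₀
  | n + 1 => fun r => u₀ + radialPotential N (fun s => f s (radialPicard N f u₀ n s)) r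

section RadialPicard

variable {N : ℕ} {f : ℝ → ℝ → ℝ} {u₀ : ℝ}

lemma continuous_radialPicard (hf : Continuous f.uncurry) (n : ℕ) :
    Continuous (radialPicard N f u₀ n) := by
  induction n with
  | zero => exact continuous_const
  | succ n ih =>
    exact continuous_const.add (continuous_radialPotential (hf.comp (continuous_id.prodMk ih)))

lemma continuous_radialPicard_source (hf : Continuous f.uncurry) (n : ℕ) :
    Continuous fun s => f s (radialPicard N f u₀ n s) :=
  hf.comp (continuous_id.prodMk (continuous_radialPicard hf n))

lemma le_radialPicard (hf0 : ∀ s w, 0 ≤ f s w) (n : ℕ) {r : ℝ} (hr : 0 ≤ r) :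
    u₀ ≤ radialPicard N f u₀ n r := by
  cases n with
  | zero => exact le_rfl
  | succ n => exact le_add_of_nonneg_right (radialPotential_nonneg hr fun s _ => hf0 _ _)

lemma radialPicard_le_succ (hf : Continuous f.uncurry) (hf0 : ∀ s w, 0 ≤ f s w)
    (hmono : ∀ s, Monotone (f s)) (n : ℕ) {r : ℝ} (hr : 0 ≤ r) :
    radialPicard N f u₀ n r ≤ radialPicard N f u₀ (n + 1) r := by
  induction n generalizing r with
  | zero => exact le_radialPicard hf0 1 hr
  | succ n ih =>
    exact add_le_add_right (radialPotential_mono (continuous_radialPicard_source hf n)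
      (continuous_radialPicard_source hf (n + 1)) hr fun s hs => hmono s (ih hs.1)) u₀

lemma monotone_radialPicard_index (hf : Continuous f.uncurry) (hf0 : ∀ s w, 0 ≤ f s w)
    (hmono : ∀ s, Monotone (f s)) {r : ℝ} (hr : 0 ≤ r) :
    Monotone fun n => radialPicard N f u₀ n r :=
  monotone_nat_of_le_succ fun n => radialPicard_le_succ hf hf0 hmono n hr

lemma hasDerivAt_radialPicard_succ (hf : Continuous f.uncurry) (n : ℕ) (r : ℝ) :
    HasDerivAt (radialPicard N f u₀ (n + 1))
      (r * radialMean N (fun s => f s (radialPicard N f u₀ n s)) r) r :=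
  (hasDerivAt_radialPotential (continuous_radialPicard_source hf n) r).const_add u₀

lemma monotoneOn_radialPicard (hf : Continuous f.uncurry) (hf0 : ∀ s w, 0 ≤ f s w) (n : ℕ) :
    MonotoneOn (radialPicard N f u₀ n) (Ici 0) := by
  cases n with
  | zero => exact fun _ _ _ _ _ => le_rfl
  | succ n =>
    refine monotoneOn_of_deriv_nonneg (convex_Ici 0) (continuous_radialPicard hf _).continuousOn
      (fun r _ => (hasDerivAt_radialPicard_succ hf n r).differentiableAt.differentiableWithinAt)
      fun r hr => ?_
    have hr : 0 ≤ r := interior_subset hr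
    rw [(hasDerivAt_radialPicard_succ hf n r).deriv]
    exact mul_nonneg hr (radialMean_nonneg hr fun s _ => hf0 _ _)

/-- The Keller–Osserman type a priori bound: divergence of `∫ 1 / k` bounds all iterates on
compact intervals. -/
lemma exists_radialPicard_le (hf : Continuous f.uncurry) (hf0 : ∀ s w, 0 ≤ f s w)
    (hmono : ∀ s, Monotone (f s)) {c k : ℝ → ℝ} (hc : Continuous c) (hk : Continuous k)
    (hkpos : ∀ w, 0 < k w) (hkmono : Monotone k) (hfk : ∀ s w, f s w ≤ c s * k w)
    (hO : Tendsto (fun t => ∫ s in u₀..t, 1 / k s) atTop atTop) {R : ℝ} (hR : 0 ≤ R) :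
    ∃ B, ∀ n, ∀ r ∈ Icc 0 R, radialPicard N f u₀ n r ≤ B := by
  obtain ⟨C, hC⟩ := (isCompact_Icc (a := (0:ℝ)) (b := R)).bddAbove_image hc.continuousOn
  have hC : ∀ s ∈ Icc 0 R, c s ≤ C := fun s hs => hC (mem_image_of_mem c hs)
  have hC0 : 0 ≤ C := by
    have h1 := (hf0 0 u₀).trans (hfk 0 u₀)
    exact (nonneg_of_mul_nonneg_left h1 (hkpos _)).trans (hC 0 ⟨le_rfl, hR⟩)
  obtain ⟨B, hB⟩ := eventually_atTop.1 (hO.eventually_gt_atTop (R * C * R))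
  have hkinv : Continuous fun s => 1 / k s := continuous_const.div hk fun s => (hkpos s).ne'
  have hsucc : ∀ n, ∀ r ∈ Icc 0 R, radialPicard N f u₀ (n + 1) r ≤ B := by
    intro n r hr
    by_contra! hlt
    have hder : ∀ t, HasDerivAt
        (fun t => ∫ s in u₀..radialPicard N f u₀ (n + 1) t, 1 / k s)
        (1 / k (radialPicard N f u₀ (n + 1) t) *
          (t * radialMean N (fun s => f s (radialPicard N f u₀ n s)) t)) t := fun t =>
      HasDerivAt.comp t (hkinv.integral_hasStrictDerivAt u₀ _).hasDerivAt
        (hasDerivAt_radialPicard_succ hf n t)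
    have hgrowth := (convex_Icc 0 R).image_sub_le_mul_sub_of_deriv_le
      (fun t _ => (hder t).continuousAt.continuousWithinAt)
      (fun t _ => (hder t).differentiableAt.differentiableWithinAt) (C := R * C)
      (fun t ht => ?_) 0 ⟨le_rfl, hR⟩ r hr hr.1
    · have hinit : radialPicard N f u₀ (n + 1) 0 = u₀ := by
        simp [radialPicard, radialPotential]
      rw [hinit, intervalIntegral.integral_same, sub_zero, sub_zero] at hgrowth
      have hRC : R * C * r ≤ R * C * R := mul_le_mul_of_nonneg_left hr.2 (mul_nonneg hR hC0)
      linarith [hB _ hlt.le]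
    · have ht : t ∈ Icc 0 R := interior_subset ht
      rw [(hder t).deriv]
      have hkt := hkpos (radialPicard N f u₀ (n + 1) t)
      have hmean : radialMean N (fun s => f s (radialPicard N f u₀ n s)) t ≤
          C * k (radialPicard N f u₀ (n + 1) t) := by
        refine radialMean_le (continuous_radialPicard_source hf n) ht.1 (fun s _ => hf0 _ _)
          fun s hs => (hfk s _).trans ?_
        have hw : radialPicard N f u₀ n s ≤ radialPicard N f u₀ (n + 1) t :=
          (radialPicard_le_succ hf hf0 hmono n hs.1).trans
            (monotoneOn_radialPicard hf hf0 (n + 1) hs.1 ht.1 hs.2)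
        exact mul_le_mul (hC s ⟨hs.1, hs.2.trans ht.2⟩) (hkmono hw) (hkpos _).le hC0
      rw [one_div, inv_mul_le_iff₀ hkt]
      calc t * radialMean N (fun s => f s (radialPicard N f u₀ n s)) t
          ≤ R * (C * k (radialPicard N f u₀ (n + 1) t)) :=
            mul_le_mul ht.2 hmean (radialMean_nonneg ht.1 fun s _ => hf0 _ _) hR
        _ = k (radialPicard N f u₀ (n + 1) t) * (R * C) := by ring
  exact ⟨B, fun n r hr => (radialPicard_le_succ hf hf0 hmono n hr.1).trans (hsucc n r hr)⟩

lemma exists_radialPicard_sub_le (hf : Continuous f.uncurry) (hf0 : ∀ s w, 0 ≤ f s w)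
    (hmono : ∀ s, Monotone (f s)) {R B : ℝ} (hR : 0 ≤ R)
    (hB : ∀ n, ∀ r ∈ Icc 0 R, radialPicard N f u₀ n r ≤ B) :
    ∃ L, ∀ n, ∀ x ∈ Icc 0 R, ∀ y ∈ Icc 0 R, x ≤ y →
      radialPicard N f u₀ n y - radialPicard N f u₀ n x ≤ L * (y - x) := by
  have hfB : Continuous fun s => f s B := hf.comp (continuous_id.prodMk continuous_const)
  obtain ⟨C, hC⟩ := (isCompact_Icc (a := (0:ℝ)) (b := R)).bddAbove_image hfB.continuousOn
  have hC : ∀ s ∈ Icc 0 R, f s B ≤ C := fun s hs => hC (mem_image_of_mem _ hs)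
  have hC0 : 0 ≤ C := (hf0 0 B).trans (hC 0 ⟨le_rfl, hR⟩)
  refine ⟨R * C, fun n x hx y hy hxy => ?_⟩
  cases n with
  | zero =>
    simpa [radialPicard] using mul_nonneg (mul_nonneg hR hC0) (sub_nonneg.2 hxy)
  | succ n =>
    refine (convex_Icc 0 R).image_sub_le_mul_sub_of_deriv_le
      (continuous_radialPicard hf _).continuousOn
      (fun t _ => (hasDerivAt_radialPicard_succ hf n t).differentiableAt.differentiableWithinAt)
      (fun t ht => ?_) x hx y hy hxy
    have ht : t ∈ Icc 0 R := interior_subset ht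
    rw [(hasDerivAt_radialPicard_succ hf n t).deriv]
    refine mul_le_mul ht.2 ?_ (radialMean_nonneg ht.1 fun s _ => hf0 _ _) hR
    refine radialMean_le (continuous_radialPicard_source hf n) ht.1 (fun s _ => hf0 _ _)
      fun s hs => ?_
    have hs' : s ∈ Icc 0 R := ⟨hs.1, hs.2.trans ht.2⟩
    exact (hmono s (hB n s hs')).trans (hC s hs')

/-- Convergence of the Picard iterates to a solution of the integral equation, given bounds on
compact intervals. -/
theorem exists_tendsto_radialPicard (hf : Continuous f.uncurry) (hf0 : ∀ s w, 0 ≤ f s w)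
    (hmono : ∀ s, Monotone (f s))
    (hbound : ∀ R, 0 ≤ R → ∃ B, ∀ n, ∀ r ∈ Icc 0 R, radialPicard N f u₀ n r ≤ B) :
    ∃ φ u : ℝ → ℝ, Continuous φ ∧ (∀ r, u r = u₀ + radialPotential N φ r) ∧
      (∀ r, 0 ≤ r → φ r = f r (u r)) ∧ (∀ r, 0 ≤ r → u₀ ≤ u r) ∧
      TendstoLocallyUniformlyOn (radialPicard N f u₀) u atTop (Ici 0) := by
  set V := radialPicard N f u₀
  set w : ℝ → ℝ := fun r => ⨆ n, V n r
  have hbdd : ∀ r, 0 ≤ r → BddAbove (range fun n => V n r) := fun r hr => by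
    obtain ⟨B, hB⟩ := hbound r hr
    exact ⟨B, by rintro _ ⟨n, rfl⟩; exact hB n r ⟨hr, le_rfl⟩⟩
  have hVw : ∀ r, 0 ≤ r → Tendsto (fun n => V n r) atTop (nhds (w r)) := fun r hr =>
    tendsto_atTop_ciSup (monotone_radialPicard_index hf hf0 hmono hr) (hbdd r hr)
  have hVle : ∀ n r, 0 ≤ r → V n r ≤ w r := fun n r hr => le_ciSup (hbdd r hr) n
  have hwcont : ContinuousOn w (Ici 0) := by
    intro x hx
    have hx : 0 ≤ x := hx
    have hR : 0 ≤ x + 1 := by linarith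
    obtain ⟨B, hB⟩ := hbound (x + 1) hR
    obtain ⟨L, hL⟩ := exists_radialPicard_sub_le hf hf0 hmono hR hB
    have hLw : ∀ y ∈ Icc 0 (x + 1), ∀ z ∈ Icc 0 (x + 1), y ≤ z → |w z - w y| ≤ L * |z - y| := by
      intro y hy z hz hyz
      have h1 : w z - w y ≤ L * (z - y) := le_of_tendsto ((hVw z hz.1).sub (hVw y hy.1))
        (Eventually.of_forall fun n => hL n y hy z hz hyz)
      have h2 : 0 ≤ w z - w y := ge_of_tendsto ((hVw z hz.1).sub (hVw y hy.1))
        (Eventually.of_forall fun n =>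
          sub_nonneg.2 (monotoneOn_radialPicard hf hf0 n hy.1 hz.1 hyz))
      rwa [abs_of_nonneg h2, abs_of_nonneg (sub_nonneg.2 hyz)]
    have hlip : ContinuousOn w (Icc 0 (x + 1)) := by
      refine (LipschitzOnWith.of_dist_le_mul (K := L.toNNReal) fun y hy z hz => ?_).continuousOn
      rw [Real.dist_eq, Real.dist_eq]
      refine le_trans ?_ (mul_le_mul_of_nonneg_right (Real.le_coe_toNNReal L) (abs_nonneg _))
      rcases le_total y z with hyz | hzy
      · rw [abs_sub_comm (w y), abs_sub_comm y]
        exact hLw y hy z hz hyz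
      · exact hLw z hz y hy hzy
    refine (hlip x ⟨hx, by linarith⟩).mono_of_mem_nhdsWithin ?_
    rw [← Ici_inter_Iic]
    exact inter_mem self_mem_nhdsWithin
      (mem_nhdsWithin_of_mem_nhds (Iic_mem_nhds (by linarith)))
  have hdini : TendstoLocallyUniformlyOn V w atTop (Ici 0) :=
    Monotone.tendstoLocallyUniformlyOn_of_forall_tendsto
      (fun n => (continuous_radialPicard hf n).continuousOn)
      (fun r hr => monotone_radialPicard_index hf hf0 hmono hr) hwcont hVw
  set φ : ℝ → ℝ := fun s => f s (w (max s 0)) with hφdef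
  have hφ : Continuous φ := hf.comp (continuous_id.prodMk
    (hwcont.comp_continuous (continuous_id.max continuous_const) fun s => le_max_right s 0))
  have hφeq : ∀ s, 0 ≤ s → φ s = f s (w s) := fun s hs => by simp [hφdef, max_eq_left hs]
  have hweq : ∀ r, 0 ≤ r → w r = u₀ + radialPotential N φ r := by
    intro r hr
    refine tendsto_nhds_unique ((hVw r hr).comp (tendsto_add_atTop_nat 1)) ?_
    refine (tendsto_radialPotential (continuous_radialPicard_source hf) hφ hr
      (fun n s _ => hf0 _ _) (fun n s hs => ?_) fun s hs => ?_).const_add u₀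
    · rw [hφeq s hs.1]
      exact hmono s (hVle n s hs.1)
    · rw [hφeq s hs.1]
      exact ((hf.comp (continuous_const.prodMk continuous_id)).tendsto (w s)).comp (hVw s hs.1)
  refine ⟨φ, fun r => u₀ + radialPotential N φ r, hφ, fun _ => rfl, fun r hr => ?_,
    fun r hr => le_add_of_nonneg_right (radialPotential_nonneg hr fun s _ => hf0 _ _), ?_⟩
  · rw [hφeq r hr, hweq r hr]
  · exact hdini.congr_right hweq

end RadialPicard

theorem stmt0 (N : ℕ) (hN : 3 ≤ N)
    (a b : ℝ → ℝ)
    (ha_cont : ContinuousOn a (Set.Ici 0)) (ha_nonneg : ∀ s ∈ Set.Ici (0:ℝ), 0 ≤ a s)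
    (hb_cont : ContinuousOn b (Set.Ici 0)) (hb_nonneg : ∀ s ∈ Set.Ici (0:ℝ), 0 ≤ b s)
    (h g : ℝ → ℝ) (s₀ : ℝ) (hs₀ : 0 < s₀)
    (hh_cont : ContinuousOn h (Set.Ici 0)) (hh_mono : MonotoneOn h (Set.Ici 0))
    (hh_nonneg : ∀ s ∈ Set.Ici (0:ℝ), 0 ≤ h s)
    (hh0 : h 0 = 0) (hh_pos : ∀ s : ℝ, 0 < s → 0 < h s)
    (hg_cont : ContinuousOn g (Set.Ioi 0))
    (hg_mono : MonotoneOn g (Set.Ioi s₀))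
    (hg_lim : Filter.Tendsto g (nhdsWithin 0 (Set.Ioi 0)) (nhds 0))
    (hg_s0 : g s₀ = 0)
    (hg_neg : ∀ s ∈ Set.Ioo 0 s₀, g s < 0)
    (hg_pos : ∀ s ∈ Set.Ioi s₀, 0 < g s)
    (u₀ : ℝ) (hu₀ : s₀ ≤ u₀)
    (hO : Filter.Tendsto (fun t : ℝ => ∫ s in u₀..t, 1 / (h s + g s)) Filter.atTop Filter.atTop)
    (U : ℕ → ℝ → ℝ) (hU0 : ∀ r : ℝ, U 0 r = u₀)
    (hUrec : ∀ n : ℕ, ∀ r : ℝ, U (n + 1) r =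
      u₀ + ∫ t in (0:ℝ)..r, t ^ (1 - (N:ℤ)) *
        ∫ s in (0:ℝ)..t, s ^ (N - 1) * (a s * h (U n s) + b s * g (U n s)))
    :
    ∃ u : ℝ → ℝ,
      TendstoLocallyUniformlyOn U u Filter.atTop (Set.Ici 0) ∧
      ContDiffOn ℝ 2 u (Set.Ici 0) ∧
      (∀ r ∈ Set.Ici (0:ℝ), u₀ ≤ u r) ∧ 0 < u₀ ∧
      (∀ r : ℝ, 0 < r →
        deriv (deriv u) r + (((N:ℝ) - 1) / r) * deriv u r
          = a r * h (u r) + b r * g (u r)) ∧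
      u 0 = u₀ ∧ deriv u 0 = 0 := by
  have hN1 : 1 ≤ N := by omega
  have hu₀pos : 0 < u₀ := hs₀.trans_le hu₀
  set A : ℝ → ℝ := fun s => a (max s 0) with hA
  set B : ℝ → ℝ := fun s => b (max s 0) with hB
  set p : ℝ → ℝ := fun w => h (max w u₀) with hp
  set q : ℝ → ℝ := fun w => g (max w u₀) with hq
  have hAcont : Continuous A :=
    ha_cont.comp_continuous (continuous_id.max continuous_const) fun s => le_max_right s 0
  have hBcont : Continuous B :=
    hb_cont.comp_continuous (continuous_id.max continuous_const) fun s => le_max_right s 0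
  have hmax : ∀ w, u₀ ≤ max w u₀ := fun w => le_max_right w u₀
  have hpcont : Continuous p :=
    hh_cont.comp_continuous (continuous_id.max continuous_const) fun w => hu₀pos.le.trans (hmax w)
  have hqcont : Continuous q :=
    hg_cont.comp_continuous (continuous_id.max continuous_const)
      fun w => hu₀pos.trans_le (hmax w)
  have hA0 : ∀ s, 0 ≤ A s := fun s => ha_nonneg _ (le_max_right s 0)
  have hB0 : ∀ s, 0 ≤ B s := fun s => hb_nonneg _ (le_max_right s 0)
  have hp0 : ∀ w, 0 < p w := fun w => hh_pos _ (hu₀pos.trans_le (hmax w))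
  have hg0 : ∀ w, s₀ ≤ w → 0 ≤ g w := fun w hw => by
    rcases hw.eq_or_lt with rfl | hlt
    · exact hg_s0.ge
    · exact (hg_pos w hlt).le
  have hq0 : ∀ w, 0 ≤ q w := fun w => hg0 _ (hu₀.trans (hmax w))
  have hpmono : Monotone p := fun v w hvw =>
    hh_mono (hu₀pos.le.trans (hmax v)) (hu₀pos.le.trans (hmax w)) (max_le_max_right u₀ hvw)
  have hqmono : Monotone q := fun v w hvw => by
    have hle : max v u₀ ≤ max w u₀ := max_le_max_right u₀ hvw
    rcases (hu₀.trans (hmax v)).eq_or_lt with heq | hlt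
    · calc q v = 0 := by rw [hq]; simp only [← heq, hg_s0]
        _ ≤ q w := hq0 w
    · exact hg_mono hlt (hlt.trans_le hle) hle
  set f : ℝ → ℝ → ℝ := fun s w => A s * p w + B s * q w with hf
  have hfcont : Continuous f.uncurry :=
    ((hAcont.comp continuous_fst).mul (hpcont.comp continuous_snd)).add
      ((hBcont.comp continuous_fst).mul (hqcont.comp continuous_snd))
  have hf0 : ∀ s w, 0 ≤ f s w := fun s w =>
    add_nonneg (mul_nonneg (hA0 s) (hp0 w).le) (mul_nonneg (hB0 s) (hq0 w))
  have hfmono : ∀ s, Monotone (f s) := fun s v w hvw =>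
    add_le_add (mul_le_mul_of_nonneg_left (hpmono hvw) (hA0 s))
      (mul_le_mul_of_nonneg_left (hqmono hvw) (hB0 s))
  have hfle : ∀ s w, f s w ≤ (A s + B s) * (p w + q w) := fun s w => by
    nlinarith [mul_nonneg (hA0 s) (hq0 w), mul_nonneg (hB0 s) (hp0 w).le]
  have hfeq : ∀ s w, 0 ≤ s → u₀ ≤ w → f s w = a s * h w + b s * g w := fun s w hs hw => by
    simp only [hf, hA, hB, hp, hq, max_eq_left hs, max_eq_left hw]
  have hO' : Tendsto (fun t => ∫ s in u₀..t, 1 / (p s + q s)) atTop atTop := by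
    refine hO.congr' ?_
    filter_upwards [eventually_ge_atTop u₀] with t ht
    refine intervalIntegral.integral_congr fun s hs => ?_
    rw [uIcc_of_le ht] at hs
    simp only [hp, hq, max_eq_left hs.1]
  obtain ⟨φ, u, hφ, hu, hφu, hu_le, hlim⟩ := exists_tendsto_radialPicard (N := N) hfcont hf0 hfmono
    fun R hR => exists_radialPicard_le hfcont hf0 hfmono (hAcont.add hBcont) (hpcont.add hqcont)
      (fun w => add_pos_of_pos_of_nonneg (hp0 w) (hq0 w)) (hpmono.add hqmono) hfle hO' hR
  have hUeq : ∀ n r, 0 ≤ r → radialPicard N f u₀ n r = U n r := by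
    intro n
    induction n with
    | zero => exact fun r _ => (hU0 r).symm
    | succ n ih =>
      intro r hr
      rw [hUrec]
      simp only [radialPicard, radialPotential]
      congr 1
      refine intervalIntegral.integral_congr fun t ht => ?_
      rw [uIcc_of_le hr] at ht
      simp only [← zpow_mul_integral_eq_mul_radialMean hN1]
      congr 1
      refine intervalIntegral.integral_congr fun s hs => ?_
      rw [uIcc_of_le ht.1] at hs
      rw [hfeq s _ hs.1 (le_radialPicard hf0 n hs.1), ih s hs.1]
  have hderiv : ∀ r, HasDerivAt u (r * radialMean N φ r) r := fun r => by
    rw [funext hu]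
    exact (hasDerivAt_radialPotential hφ r).const_add u₀
  have hderiv_eq : deriv u = fun r => r * radialMean N φ r := funext fun r => (hderiv r).deriv
  refine ⟨u, hlim.congr fun n r hr => hUeq n r hr, ?_, hu_le, hu₀pos, fun r hr => ?_, ?_, ?_⟩
  · rw [funext hu]
    exact (contDiff_const.add (contDiff_two_radialPotential hN1 hφ)).contDiffOn
  · rw [hderiv_eq, (hasDerivAt_mul_radialMean hN1 hφ r).deriv, hφu r hr.le,
      hfeq r _ hr.le (hu_le r hr.le)]
    field_simp
    ring
  · simp [hu, radialPotential]
  · simp [hderiv_eq]
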